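/- Let α > 0 and s₀ ∈ ℝ. There is no twice differentiable function M : [s₀, ∞) → ℝ satisfying M(s) > 0, M'(s) > 0, and M(s) M''(s) ≥ (1+α) (M'(s))² for all s ≥ s₀. (Equivalently, if M is twice differentiable on [s₀,∞) with M > 0, M' > 0 and the concavity inequality M M'' ≥ (1+α)(M')², then a contradiction follows, since Y = M^{−α} would be positive, decreasing and concave on [s₀,∞).) -/

import Mathlib

/-- Levine's concavity lemma: for `α > 0` and `s₀ ∈ ℝ`,
there is no twice differentiable `M : [s₀,∞) → ℝ` with `M > 0`, `M' > 0` and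
`M M'' ≥ (1+α)(M')²` on `[s₀,∞)` (otherwise `Y = M^{−α}` would be positive,
decreasing and concave on `[s₀,∞)`, a contradiction). -/
theorem stmt17 (α : ℝ) (hα : 0 < α) (s₀ : ℝ) :
    ¬ ∃ M : ℝ → ℝ,
      (∀ s, s₀ ≤ s → DifferentiableAt ℝ M s) ∧
      (∀ s, s₀ ≤ s → DifferentiableAt ℝ (deriv M) s) ∧
      (∀ s, s₀ ≤ s → 0 < M s) ∧
      (∀ s, s₀ ≤ s → 0 < deriv M s) ∧
      (∀ s, s₀ ≤ s → (1 + α) * (deriv M s) ^ 2 ≤ M s * deriv (deriv M) s) := by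
  rintro ⟨M, h1, h2, hM, hP, h⟩
  have hd : ∀ s, s₀ ≤ s → HasDerivAt (fun s => M s / deriv M s)
      ((deriv M s * deriv M s - M s * deriv (deriv M) s) / (deriv M s) ^ 2) s :=
    fun s hs => (h1 s hs).hasDerivAt.div (h2 s hs).hasDerivAt (hP s hs).ne'
  have hg : ∀ s, s₀ ≤ s → 0 < M s / deriv M s := fun s hs => div_pos (hM s hs) (hP s hs)
  have hg0 := hg s₀ le_rfl
  set t := s₀ + (M s₀ / deriv M s₀) / α with ht
  have hst : s₀ ≤ t := by
    have : 0 < (M s₀ / deriv M s₀) / α := div_pos hg0 hα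
    linarith
  have key := (convex_Ici s₀).image_sub_le_mul_sub_of_deriv_le
    (f := fun s => M s / deriv M s) (C := -α)
    (fun s hs => (hd s hs).continuousAt.continuousWithinAt)
    (fun s hs => (hd s (interior_subset hs)).differentiableAt.differentiableWithinAt)
    (fun s hs => by
      have hs1 : s₀ ≤ s := interior_subset hs
      rw [(hd s hs1).deriv, div_le_iff₀ (pow_pos (hP s hs1) 2)]
      nlinarith [h s hs1])
    s₀ (Set.mem_Ici.2 le_rfl) t hst hst
  have h3 : α * (t - s₀) = M s₀ / deriv M s₀ := by
    rw [ht, add_sub_cancel_left, mul_div_cancel₀ _ hα.ne']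
  have h4 := hg t hst
  linarith
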